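/- Asymptotic one-to-one correspondence between complete-SP rows and double-SP-supported rows: fix 0 < q < 1. For each N ≥ 4, let μ_N be the product Bernoulli(q) measure on Fin N → Fin N → Bool, let the double-SF set be φ_N = {(0,0),(1,1)}, let A_N = {X 0 0 = true ∧ X 1 1 = true}, let E_N = {row 2 is a complete-SP row}, and let E₂,N = {X 2 0 = true ∧ X 2 1 = true}. Then the conditional probability μ_N(E₂,N | E_N ∩ A_N) tends to 1 as N → ∞. -/

import Mathlib

open MeasureTheory

/-- Bernoulli(q) measure on `Bool`: `true` has probability `q`. -/
noncomputable def bern (q : ℝ) : Measure Bool :=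
  (ENNReal.ofReal q) • Measure.dirac true + (ENNReal.ofReal (1 - q)) • Measure.dirac false

instance (q : ℝ) : IsFiniteMeasure (bern q) := by
  constructor
  simp [bern, Measure.add_apply, Measure.smul_apply]

/-- Product measure on `Fin N → Fin N → Bool` making the `N²` entries i.i.d. Bernoulli(q). -/
noncomputable def arrMeasure (N : ℕ) (q : ℝ) : Measure (Fin N → Fin N → Bool) :=
  Measure.pi fun _ => Measure.pi fun _ => bern q

/-- Cell `(m,n)` is an SP cell for the double-SF set `{(i,j),(i',j')}` (both active). -/
def IsSPCellDouble (N : ℕ) (X : Fin N → Fin N → Bool)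
    (i i' j j' m n : Fin N) : Prop :=
  X m n = false ∧
    ((X i n = true ∧ X m j = true) ∨ (X i' n = true ∧ X m j' = true))

/-- Row `m` is a complete-SP row: it contains an SP cell, and every critical cell
`(m,n)` with `n ∉ {j,j'}` (row `m` SP-supported and column `n` SP-supported) is
either LRS (`true`) or an SP cell. -/
def IsCompleteSPRow (N : ℕ) (X : Fin N → Fin N → Bool)
    (i i' j j' m : Fin N) : Prop :=
  (∃ n : Fin N, IsSPCellDouble N X i i' j j' m n) ∧
  ∀ n : Fin N, n ≠ j → n ≠ j' → (X m j = true ∨ X m j' = true) →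
    (X i n = true ∨ X i' n = true) →
    X m n = true ∨ IsSPCellDouble N X i i' j j' m n

/-- The conditional probability, in a `(K+4) × (K+4)` array with double-SF set
`{(0,0),(1,1)}`, given both SFs active and row `2` a complete-SP row, that row `2`
is double-SP-supported (`X 2 0 = true ∧ X 2 1 = true`). -/
noncomputable def condProbDoubleSupported (q : ℝ) (K : ℕ) : ENNReal :=
  let N := K + 4
  let i : Fin N := ⟨0, by omega⟩
  let i' : Fin N := ⟨1, by omega⟩
  let m : Fin N := ⟨2, by omega⟩
  let j : Fin N := ⟨0, by omega⟩
  let j' : Fin N := ⟨1, by omega⟩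
  let A : Set (Fin N → Fin N → Bool) := {X | X i j = true ∧ X i' j' = true}
  let E : Set (Fin N → Fin N → Bool) := {X | IsCompleteSPRow N X i i' j j' m}
  let E2 : Set (Fin N → Fin N → Bool) := {X | X m j = true ∧ X m j' = true}
  (arrMeasure N q) (E2 ∩ (E ∩ A)) / (arrMeasure N q) (E ∩ A)


lemma bern_prob {q : ℝ} (hq0 : 0 < q) (hq1 : q < 1) : IsProbabilityMeasure (bern q) := by
  constructor
  simp only [bern, Measure.add_apply, Measure.smul_apply, smul_eq_mul, measure_univ, mul_one]
  rw [← ENNReal.ofReal_add hq0.le (by linarith)]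
  simp

lemma bern_true (q : ℝ) : bern q {true} = ENNReal.ofReal q := by
  simp [bern]

lemma bern_false (q : ℝ) : bern q {false} = ENNReal.ofReal (1 - q) := by
  simp [bern]

/-- box on three first coordinates -/
def box3 (K : ℕ) (a b c : Set Bool) (k : Fin (K + 4)) : Set Bool :=
  if k.val = 0 then a else if k.val = 1 then b else if k.val = 2 then c else Set.univ

lemma pi_box3 {q : ℝ} (hq0 : 0 < q) (hq1 : q < 1) (K : ℕ) (a b c : Set Bool) :
    (Measure.pi fun _ : Fin (K + 4) => bern q) (Set.pi Set.univ (box3 K a b c))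
      = bern q a * bern q b * bern q c := by
  haveI := bern_prob hq0 hq1
  have hu : bern q {false, true} = 1 := by
    rw [← measure_univ (μ := bern q)]; congr 1; ext x; cases x <;> simp
  have hm : 2 % (K + 4) = 2 := Nat.mod_eq_of_lt (by omega)
  rw [Measure.pi_pi, Fin.prod_univ_succ, Fin.prod_univ_succ, Fin.prod_univ_succ]
  simp [box3, mul_assoc, hu, hm]

lemma arr_singleton (q : ℝ) (N : ℕ) (X : Fin N → Fin N → Bool) :
    arrMeasure N q {X} = ∏ i, ∏ j, bern q {X i j} := by
  rw [arrMeasure, Measure.pi_singleton]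
  simp_rw [Measure.pi_singleton]

lemma arr_swap (q : ℝ) (N : ℕ) (S : Set (Fin N → Fin N → Bool)) :
    arrMeasure N q {X | (fun i j => X j i) ∈ S} = arrMeasure N q S := by
  have h : (arrMeasure N q).map (fun X i j => X j i) = arrMeasure N q := by
    apply Measure.ext_of_singleton
    intro X
    rw [Measure.map_apply (measurable_of_finite _) (Set.toFinite _).measurableSet]
    have : (fun (X : Fin N → Fin N → Bool) i j => X j i) ⁻¹' {X} = {fun i j => X j i} := by
      ext Y
      simp only [Set.mem_preimage, Set.mem_singleton_iff]
      constructor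
      · rintro rfl; rfl
      · rintro rfl; rfl
    rw [this, arr_singleton, arr_singleton, Finset.prod_comm]
  conv_rhs => rw [← h]
  rw [Measure.map_apply (measurable_of_finite _) (Set.toFinite _).measurableSet]
  rfl

lemma arr_bad {q : ℝ} (hq0 : 0 < q) (hq1 : q < 1) (K : ℕ) (a b c : Set Bool) :
    arrMeasure (K + 4) q {X | ∀ n : Fin (K + 4), 2 ≤ n.val →
      (fun i => X i n) ∉ Set.pi Set.univ (box3 K a b c)}
      = (1 - bern q a * bern q b * bern q c) ^ (K + 2) := by
  haveI := bern_prob hq0 hq1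
  have e : {X : Fin (K + 4) → Fin (K + 4) → Bool | ∀ n : Fin (K + 4), 2 ≤ n.val →
      (fun i => X i n) ∉ Set.pi Set.univ (box3 K a b c)} =
      {X | (fun i j => X j i) ∈ Set.pi Set.univ (fun n : Fin (K + 4) =>
        if 2 ≤ n.val then (Set.pi Set.univ (box3 K a b c))ᶜ else Set.univ)} := by
    ext X
    simp only [Set.mem_setOf_eq]
    rw [Set.mem_univ_pi]
    refine forall_congr' fun n => ?_
    by_cases hn : 2 ≤ n.val
    · rw [if_pos hn]; exact ⟨fun h => h hn, fun h _ => h⟩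
    · rw [if_neg hn]; exact ⟨fun _ => trivial, fun _ h => absurd h hn⟩
  rw [e, arr_swap, arrMeasure, Measure.pi_pi, Fin.prod_univ_succ, Fin.prod_univ_succ]
  have hc : (Measure.pi fun _ : Fin (K + 4) => bern q) (Set.pi Set.univ (box3 K a b c))ᶜ
      = 1 - bern q a * bern q b * bern q c := by
    rw [prob_compl_eq_one_sub (Set.toFinite _).measurableSet, pi_box3 hq0 hq1]
  simp [hc]

lemma arr_good {q : ℝ} (hq0 : 0 < q) (hq1 : q < 1) (K : ℕ) :
    ∃ S : Set (Fin (K + 4) → Fin (K + 4) → Bool),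
      arrMeasure (K + 4) q S = bern q {true} * bern q {true} * bern q {true} *
        (bern q {true} * bern q {true} * bern q {false}) ∧
      ∀ X ∈ S, X 0 0 = true ∧ X 1 1 = true ∧ X 0 2 = true ∧ X 2 0 = true ∧ X 2 1 = true ∧
        X 2 2 = false := by
  haveI := bern_prob hq0 hq1
  have hu : bern q {false, true} = 1 := by
    rw [← measure_univ (μ := bern q)]; congr 1; ext x; cases x <;> simp
  have hm : 2 % (K + 4) = 2 := Nat.mod_eq_of_lt (by omega)
  refine ⟨Set.pi Set.univ fun i : Fin (K + 4) => Set.pi Set.univ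
    (if i.val = 0 then box3 K {true} Set.univ {true} else
      if i.val = 1 then box3 K Set.univ {true} Set.univ else
      if i.val = 2 then box3 K {true} {true} {false} else
      box3 K Set.univ Set.univ Set.univ), ?_, ?_⟩
  · rw [arrMeasure, Measure.pi_pi, Fin.prod_univ_succ, Fin.prod_univ_succ, Fin.prod_univ_succ]
    simp [pi_box3 hq0 hq1, mul_assoc, hu, hm, -Measure.pi_pi]
  · intro X hX
    have h := fun i j => (hX i trivial) j trivial
    have v2 : ((2 : Fin (K + 4)) : ℕ) = 2 := rfl
    have h00 := h 0 0
    have h11 := h 1 1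
    have h02 := h 0 2
    have h20 := h 2 0
    have h21 := h 2 1
    have h22 := h 2 2
    simp [box3, v2] at h00 h11 h02 h20 h21 h22
    exact ⟨h00, h11, h02, h20, h21, h22⟩

lemma row_bad (K : ℕ) (X : Fin (K + 4) → Fin (K + 4) → Bool)
    (h : IsCompleteSPRow (K + 4) X 0 1 0 1 2) (h2 : ¬ (X 2 0 = true ∧ X 2 1 = true)) :
    (∀ n : Fin (K + 4), 2 ≤ n.val → ¬ (X 0 n = false ∧ X 1 n = true ∧ X 2 n = false)) ∨
    (∀ n : Fin (K + 4), 2 ≤ n.val → ¬ (X 0 n = true ∧ X 1 n = false ∧ X 2 n = false)) := by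
  obtain ⟨⟨n0, hn0⟩, hall⟩ := h
  have key : ∀ n : Fin (K + 4), 2 ≤ n.val → n ≠ 0 ∧ n ≠ 1 := by
    intro n hn
    constructor
    · rintro rfl; simp at hn
    · rintro rfl; simp at hn
  unfold IsSPCellDouble at *
  by_cases h20 : X 2 0 = true
  · left
    intro n hn hb
    have := hall n (key n hn).1 (key n hn).2
    simp_all
  · right
    intro n hn hb
    have := hall n (key n hn).1 (key n hn).2
    simp_all

theorem complete_sp_row_double_supported_tendsto_one
    (q : ℝ) (hq0 : 0 < q) (hq1 : q < 1) :
    Filter.Tendsto (condProbDoubleSupported q) Filter.atTop (nhds 1) := by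
  haveI := bern_prob hq0 hq1
  have ht : bern q {true} ≠ 0 := by rw [bern_true]; simpa using hq0
  have hf : bern q {false} ≠ 0 := by rw [bern_false]; simpa using hq1
  set t := bern q {true} with ht'
  set f := bern q {false} with hf'
  set c := t * t * t * (t * t * f) with hc
  have hc0 : c ≠ 0 := by simp [hc, ht, hf]
  set p := f * t * f with hp
  set p' := t * f * f with hp'
  have hpp : p' = p := by rw [hp, hp', mul_comm t f]
  have hp0 : p ≠ 0 := by simp [hp, ht, hf]
  have hlt : 1 - p < 1 := ENNReal.sub_lt_self (by simp) (by simp) hp0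
  have hb : Filter.Tendsto (fun K : ℕ => 1 - 2 * (1 - p) ^ (K + 2) / c) Filter.atTop (nhds 1) := by
    have h1 : Filter.Tendsto (fun K : ℕ => (1 - p) ^ (K + 2)) Filter.atTop (nhds 0) :=
      (Filter.tendsto_add_atTop_iff_nat 2).2 (ENNReal.tendsto_pow_atTop_nhds_zero_of_lt_one hlt)
    have h2 : Filter.Tendsto (fun K : ℕ => 2 * (1 - p) ^ (K + 2) / c) Filter.atTop (nhds 0) := by
      have := ENNReal.Tendsto.div_const
        (ENNReal.Tendsto.const_mul (a := 2) h1 (Or.inr (by simp))) (b := c) (Or.inr hc0)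
      simpa using this
    have h3 := ENNReal.Tendsto.sub (tendsto_const_nhds (x := (1 : ENNReal))
      (f := Filter.atTop (α := ℕ))) h2 (Or.inl (by simp))
    simpa using h3
  refine tendsto_of_tendsto_of_tendsto_of_le_of_le hb tendsto_const_nhds ?_ ?_
  · intro K
    haveI : IsProbabilityMeasure (arrMeasure (K + 4) q) := by unfold arrMeasure; infer_instance
    set A : Set (Fin (K + 4) → Fin (K + 4) → Bool) := {X | X 0 0 = true ∧ X 1 1 = true} with hA
    set E : Set (Fin (K + 4) → Fin (K + 4) → Bool) := {X | IsCompleteSPRow (K + 4) X 0 1 0 1 2}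
      with hE
    set E2 : Set (Fin (K + 4) → Fin (K + 4) → Bool) := {X | X 2 0 = true ∧ X 2 1 = true} with hE2
    have hdef : condProbDoubleSupported q K =
      (arrMeasure (K + 4) q) (E2 ∩ (E ∩ A)) / (arrMeasure (K + 4) q) (E ∩ A) := rfl
    show 1 - 2 * (1 - p) ^ (K + 2) / c ≤ condProbDoubleSupported q K
    rw [hdef]
    set M := arrMeasure (K + 4) q with hM
    obtain ⟨S, hS, hSX⟩ := arr_good hq0 hq1 K
    have hcle : c ≤ M (E ∩ A) := by
      have : M S = c := hS
      rw [← this]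
      apply measure_mono
      intro X hX
      obtain ⟨h00, h11, h02, h20, h21, h22⟩ := hSX X hX
      refine ⟨⟨⟨2, h22, Or.inl ⟨h02, h20⟩⟩, ?_⟩, h00, h11⟩
      intro n _ _ _ hn
      by_cases hx : X 2 n = true
      · exact Or.inl hx
      · right
        refine ⟨by simpa using hx, ?_⟩
        rcases hn with hn | hn
        · exact Or.inl ⟨hn, h20⟩
        · exact Or.inr ⟨hn, h21⟩
    have hbad : M ((E ∩ A) \ E2) ≤ 2 * (1 - p) ^ (K + 2) := by
      have h1 := arr_bad hq0 hq1 K {false} {true} {false}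
      have h2 := arr_bad hq0 hq1 K {true} {false} {false}
      rw [← ht', ← hf', ← hM] at h1 h2
      rw [← hp] at h1
      rw [← hp', hpp] at h2
      rw [two_mul]
      conv_rhs => rw [← h1]
      rw [h1]
      conv_rhs => 
        congr
        · rw [← h1]
        · rw [← h2]
      refine le_trans (measure_mono ?_) (measure_union_le _ _)
      rintro X ⟨⟨hXE, _⟩, hX2⟩
      rcases row_bad K X hXE hX2 with h | h
      · left
        intro n hn hmem
        exact h n hn ⟨hmem 0 trivial, hmem 1 trivial, hmem 2 trivial⟩
      · right
        intro n hn hmem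
        exact h n hn ⟨hmem 0 trivial, hmem 1 trivial, hmem 2 trivial⟩
    have hne : M (E ∩ A) ≠ 0 := fun h => hc0 (by simpa [h] using hcle)
    have hsum : M (E2 ∩ (E ∩ A)) + M ((E ∩ A) \ E2) = M (E ∩ A) := by
      rw [Set.inter_comm]
      exact measure_inter_add_diff _ (Set.toFinite _).measurableSet
    rw [tsub_le_iff_right]
    calc (1 : ENNReal) = M (E ∩ A) / M (E ∩ A) :=
          (ENNReal.div_self hne (measure_ne_top _ _)).symm
      _ = M (E2 ∩ (E ∩ A)) / M (E ∩ A) + M ((E ∩ A) \ E2) / M (E ∩ A) := by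
          rw [← ENNReal.add_div, hsum]
      _ ≤ _ := by
          gcongr
  · intro K
    exact ENNReal.div_le_of_le_mul (by
      rw [one_mul]; exact measure_mono Set.inter_subset_right)
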